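/- For every real number x with |x| < pi/2, the series sum over n >= 1 of b(n,0) x^n / n! converges and its sum equals (x - 1 + cos x)/(1 - sin x), where b(n,0) is the total number of leaves in all non-plane 1-2 trees on [n]. -/

import Mathlib

namespace BalancedTrees

/-- Plane binary trees with vertices labeled by natural numbers;
`nil` is the empty tree, and each child of a vertex is designated
as a left child or a right child. -/
inductive BT where
  | nil : BT
  | node (label : ℕ) (l r : BT) : BT
deriving DecidableEq

namespace BT

/-- `balRank t = some k` if and only if the root of `t` is a balanced vertex of
rank `k`, i.e. every descending path from the root to a leaf has length `k`. -/
def balRank : BT → Option ℕ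
  | .nil => none
  | .node _ .nil .nil => some 0
  | .node _ .nil (.node b rl rr) => (balRank (BT.node b rl rr)).map (· + 1)
  | .node _ (.node a ll lr) .nil => (balRank (BT.node a ll lr)).map (· + 1)
  | .node _ (.node a ll lr) (.node b rl rr) =>
      match balRank (BT.node a ll lr), balRank (BT.node b rl rr) with
      | some i, some j => if i = j then some (i + 1) else none
      | _, _ => none

/-- The number of balanced vertices of rank `k` in the tree `t`. -/
def countBal (k : ℕ) : BT → ℕ
  | .nil => 0
  | .node v l r =>
      countBal k l + countBal k r +
        (if balRank (BT.node v l r) = some k then 1 else 0)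

/-- The number of balanced vertices (of any rank) in the tree `t`. -/
def countBalAll : BT → ℕ
  | .nil => 0
  | .node v l r =>
      countBalAll l + countBalAll r +
        (if (balRank (BT.node v l r)).isSome then 1 else 0)

/-- Auxiliary, fuelled version of `treeOf`. -/
def treeOfAux : ℕ → List ℕ → BT
  | 0, _ => .nil
  | _ + 1, [] => .nil
  | fuel + 1, l =>
      let m := l.foldr max 0
      BT.node m (treeOfAux fuel (l.takeWhile (· != m)))
                (treeOfAux fuel ((l.dropWhile (· != m)).tail))

/-- The decreasing binary tree `T(π)` of a sequence `π` of distinct labels: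
the root is the maximum entry, and its left (resp. right) subtree is built
recursively from the part of the sequence to the left (resp. right) of the
maximum. This is a bijection between permutations of `{1,…,n}` and
decreasing binary trees on `{1,…,n}`. -/
def treeOf (l : List ℕ) : BT := treeOfAux l.length l

/-- Canonical form for non-plane 1-2 trees (as represented by plane trees):
an only child is stored as a left child, and of two (unordered) children the
one with the larger label is stored on the left. Decreasing binary trees in
canonical form are in bijection with non-plane 1-2 trees. -/
def canonNP : BT → Bool
  | .nil => true
  | .node _ l r =>
      canonNP l && canonNP r &&
        (match l, r with
         | .nil, .nil => true
         | .node _ _ _, .nil => true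
         | .nil, .node _ _ _ => false
         | .node a _ _, .node b _ _ => decide (b < a))

/-- Canonical form for plane 1-2 trees: an only child is stored as a left
child (an only child carries no left/right designation), while two children
remain ordered. Decreasing binary trees in canonical form are in bijection
with plane 1-2 trees. -/
def canonP : BT → Bool
  | .nil => true
  | .node _ l r =>
      canonP l && canonP r &&
        (match l, r with
         | .nil, .node _ _ _ => false
         | _, _ => true)

end BT

open BT

/-- The list of all permutations of `{1,…,n}`, each written as a list. -/
def perms (n : ℕ) : List (List ℕ) := (List.range' 1 n).permutations

/-- `a n k`: the total number of balanced vertices of rank `k` over all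
decreasing binary trees on `{1,…,n}`. -/
def a (n k : ℕ) : ℕ := ((perms n).map fun l => countBal k (treeOf l)).sum

/-- `r n k`: the number of decreasing binary trees on `{1,…,n}` whose root is
balanced of rank `k`. -/
def r (n k : ℕ) : ℕ :=
  ((perms n).filter fun l => decide (balRank (treeOf l) = some k)).length

/-- `p n k`: the probability that the root of a uniformly random decreasing
binary tree on `{1,…,n}` is balanced of rank `k`; by convention `p 0 k = 1`. -/
def p (n k : ℕ) : ℚ := if n = 0 then 1 else (r n k : ℚ) / (Nat.factorial n : ℚ)

/-- The number of decreasing binary trees on `{1,…,n}` whose root is balanced. -/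
def rootBal (n : ℕ) : ℕ :=
  ((perms n).filter fun l => (balRank (treeOf l)).isSome).length

/-- `proot n`: the probability that the root of a uniformly random decreasing
binary tree on `{1,…,n}` is balanced. -/
def proot (n : ℕ) : ℚ := (rootBal n : ℚ) / (Nat.factorial n : ℚ)

/-- The total number of balanced vertices over all decreasing binary trees
on `{1,…,n}`. -/
def totalBal (n : ℕ) : ℕ := ((perms n).map fun l => countBalAll (treeOf l)).sum

/-- `Pbal n`: the probability that a vertex chosen uniformly at random from
the `n * n!` vertices of all decreasing binary trees on `{1,…,n}` is balanced. -/
def Pbal (n : ℕ) : ℚ := (totalBal n : ℚ) / ((n : ℚ) * (Nat.factorial n : ℚ))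

/-- Permutations whose decreasing binary tree is a canonical representative
of a non-plane 1-2 tree; these are in bijection with non-plane 1-2 trees
on `{1,…,n}`. -/
def npPerms (n : ℕ) : List (List ℕ) := (perms n).filter fun l => canonNP (treeOf l)

/-- `E n`: the number of non-plane 1-2 trees on `{1,…,n}` (the Euler number). -/
def E (n : ℕ) : ℕ := (npPerms n).length

/-- `b n k`: the total number of balanced vertices of rank `k` over all
non-plane 1-2 trees on `{1,…,n}`. -/
def b (n k : ℕ) : ℕ := ((npPerms n).map fun l => countBal k (treeOf l)).sum

/-- `s n k`: the number of non-plane 1-2 trees on `{1,…,n}` whose root is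
balanced of rank `k`. -/
def s (n k : ℕ) : ℕ :=
  ((npPerms n).filter fun l => decide (balRank (treeOf l) = some k)).length

/-- Permutations whose decreasing binary tree is a canonical representative
of a plane 1-2 tree; these are in bijection with plane 1-2 trees on `{1,…,n}`. -/
def pPerms (n : ℕ) : List (List ℕ) := (perms n).filter fun l => canonP (treeOf l)

/-- `z n`: the number of plane 1-2 trees on `{1,…,n}`. -/
def z (n : ℕ) : ℕ := (pPerms n).length

/-- `d n k`: the total number of balanced vertices of rank `k` over all
plane 1-2 trees on `{1,…,n}`. -/
def d (n k : ℕ) : ℕ := ((pPerms n).map fun l => countBal k (treeOf l)).sum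

/-- `t n k`: the number of plane 1-2 trees on `{1,…,n}` whose root is
balanced of rank `k`. -/
def t (n k : ℕ) : ℕ :=
  ((pPerms n).filter fun l => decide (balRank (treeOf l) = some k)).length

end BalancedTrees

open BalancedTrees

namespace BalancedTrees

open BT

lemma foldr_max_le {l : List ℕ} {m : ℕ} (h : ∀ x ∈ l, x ≤ m) : l.foldr max 0 ≤ m := by
  induction l with
  | nil => simp
  | cons a l ih => simp_all

lemma le_foldr_max {l : List ℕ} {x : ℕ} (h : x ∈ l) : x ≤ l.foldr max 0 := by
  induction l with
  | nil => simp at h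
  | cons a l ih => grind

lemma foldr_max_eq {l : List ℕ} {m : ℕ} (hm : m ∈ l) (h : ∀ x ∈ l, x ≤ m) :
    l.foldr max 0 = m :=
  le_antisymm (foldr_max_le h) (le_foldr_max hm)

lemma foldr_max_mem {l : List ℕ} (h : l ≠ []) : l.foldr max 0 ∈ l := by
  induction l with
  | nil => simp at h
  | cons a l ih =>
    rcases eq_or_ne l [] with rfl | hl
    · simp
    · have := ih hl
      grind

lemma length_takeWhile_ne_lt {l : List ℕ} {m : ℕ} (h : m ∈ l) :
    (l.takeWhile (· != m)).length < l.length := by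
  induction l with
  | nil => simp at h
  | cons a l ih =>
    by_cases ha : a = m
    · simp [ha]
    · simpa [ha] using ih ((List.mem_cons.1 h).resolve_left (Ne.symm ha))

lemma length_tail_dropWhile_lt {l : List ℕ} (p : ℕ → Bool) (h : l ≠ []) :
    ((l.dropWhile p).tail).length < l.length := by
  have h1 := (List.dropWhile_suffix p (l := l)).length_le
  have h2 := List.length_pos_iff.2 h
  rw [List.length_tail]
  omega

/-- The value of `treeOfAux` does not depend on the fuel once there is enough of it. -/
lemma treeOfAux_eq_treeOfAux {n n' : ℕ} {l : List ℕ} (h : l.length ≤ n) (h' : l.length ≤ n') :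
    treeOfAux n l = treeOfAux n' l := by
  induction n generalizing n' l with
  | zero =>
    obtain rfl : l = [] := by simpa using h
    cases n' <;> rfl
  | succ n ih =>
    cases n' with
    | zero =>
      obtain rfl : l = [] := by simpa using h'
      rfl
    | succ n' =>
      cases l with
      | nil => rfl
      | cons a l =>
        have hne : a :: l ≠ [] := by simp
        have h1 := length_takeWhile_ne_lt (foldr_max_mem hne)
        have h2 := length_tail_dropWhile_lt (· != (a :: l).foldr max 0) hne
        simp only [treeOfAux]
        rw [ih (n' := n') (by omega) (by omega), ih (n' := n') (by omega) (by omega)]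

lemma treeOf_append_cons {u v : List ℕ} {m : ℕ} (hu : ∀ x ∈ u, x < m) (hv : ∀ x ∈ v, x < m) :
    treeOf (u ++ m :: v) = BT.node m (treeOf u) (treeOf v) := by
  have hne : u ++ m :: v ≠ [] := by simp
  have hlen : (u ++ m :: v).length = (u.length + v.length) + 1 := by simp; omega
  have hmax : (u ++ m :: v).foldr max 0 = m := foldr_max_eq (by simp) (by grind)
  have ht : (u ++ m :: v).takeWhile (· != m) = u := by
    rw [List.takeWhile_append_of_pos (by grind)]; simp
  have hd : ((u ++ m :: v).dropWhile (· != m)).tail = v := by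
    rw [List.dropWhile_append_of_pos (by grind)]; simp
  unfold treeOf
  rw [hlen, treeOfAux.eq_3 _ _ (by simp)]
  simp only [hmax, ht, hd]
  rw [treeOfAux_eq_treeOfAux (l := u) (by omega) le_rfl,
    treeOfAux_eq_treeOfAux (l := v) (by omega) le_rfl]

lemma treeOf_cons (x : ℕ) (l : List ℕ) :
    ∃ t t', treeOf (x :: l) = BT.node ((x :: l).foldr max 0) t t' :=
  ⟨_, _, rfl⟩

/-- The canonical arrangements of a finite set of labels: these represent the
non-plane 1-2 trees on that set. -/
def canonical (S : Finset ℕ) : Finset (List ℕ) :=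
  {l ∈ (⟨S.val.lists, Multiset.lists_nodup_finset S⟩ : Finset (List ℕ)) | canonNP (treeOf l)}

lemma mem_canonical {S : Finset ℕ} {l : List ℕ} :
    l ∈ canonical S ↔ (l.Nodup ∧ l.toFinset = S) ∧ canonNP (treeOf l) := by
  simp only [canonical, Finset.mem_filter, Finset.mem_mk, Multiset.mem_lists_iff,
    and_congr_left_iff]
  intro _
  constructor
  · intro h
    have hl : (l : Multiset ℕ).Nodup := by
      rw [← Multiset.quot_mk_to_coe, ← h]; exact S.nodup
    refine ⟨Multiset.coe_nodup.1 hl, ?_⟩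
    ext x
    rw [List.mem_toFinset, ← Finset.mem_val, h]
    rfl
  · rintro ⟨hl, rfl⟩
    rw [List.toFinset_val, hl.dedup]
    rfl

lemma canonical_empty : canonical ∅ = {[]} := by
  ext l
  rw [mem_canonical, Finset.mem_singleton]
  constructor
  · rintro ⟨⟨-, h⟩, -⟩
    simpa using h
  · rintro rfl
    simp [treeOf, treeOfAux, canonNP]

lemma treeOf_singleton (m : ℕ) : treeOf [m] = BT.node m BT.nil BT.nil :=
  treeOf_append_cons (u := []) (v := []) (by simp) (by simp)

lemma canonical_singleton (m : ℕ) : canonical {m} = {[m]} := by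
  ext l
  rw [mem_canonical, Finset.mem_singleton]
  constructor
  · rintro ⟨⟨hl, h⟩, -⟩
    have hc := List.toFinset_card_of_nodup hl
    rw [h, Finset.card_singleton] at hc
    obtain ⟨a, rfl⟩ := List.length_eq_one_iff.1 hc.symm
    simpa using h
  · rintro rfl
    simp [treeOf_singleton, canonNP]

lemma canonNP_append_cons {u v : List ℕ} {m m' : ℕ} (hu : ∀ x ∈ u, x < m)
    (hv : ∀ x ∈ v, x < m) (hd : u.Disjoint v) (hm' : m' ∈ u ∨ m' ∈ v)
    (hu' : ∀ x ∈ u, x ≤ m') (hv' : ∀ x ∈ v, x ≤ m') :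
    canonNP (treeOf (u ++ m :: v)) ↔ (canonNP (treeOf u) ∧ canonNP (treeOf v)) ∧ m' ∈ u := by
  rw [treeOf_append_cons hu hv, canonNP.eq_def]
  dsimp only
  rw [Bool.and_eq_true, Bool.and_eq_true, and_congr_right_iff]
  intro _
  cases u with
  | nil =>
    cases v with
    | nil => simp at hm'
    | cons y v =>
      simp [treeOf, treeOfAux]
  | cons x u =>
    obtain ⟨s, s', hs⟩ := treeOf_cons x u
    cases v with
    | nil =>
      rw [hs]
      simpa [treeOf, treeOfAux] using hm'
    | cons y v =>
      obtain ⟨t, t', ht⟩ := treeOf_cons y v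
      simp only [hs, ht, decide_eq_true_eq]
      have h1 := foldr_max_mem (List.cons_ne_nil x u)
      have h2 := foldr_max_mem (List.cons_ne_nil y v)
      constructor
      · intro h
        rcases hm' with hm' | hm'
        · exact hm'
        · rw [foldr_max_eq hm' hv'] at h
          exact absurd (hu' _ h1) (not_le.2 h)
      · intro h
        rw [foldr_max_eq h hu']
        exact lt_of_le_of_ne (hv' _ h2) fun he => hd h (he ▸ h2)

lemma sum_canonical_insert_insert {M : Type*} [AddCommMonoid M] {T : Finset ℕ} {m m' : ℕ}
    (hT : ∀ x ∈ T, x < m') (hm : m' < m) (w : List ℕ → M) :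
    ∑ l ∈ canonical (insert m (insert m' T)), w l =
      ∑ A ∈ T.powerset, ∑ u ∈ canonical (insert m' A), ∑ v ∈ canonical (T \ A),
        w (u ++ m :: v) := by
  have key : ∀ A ⊆ T, ∀ u ∈ canonical (insert m' A), ∀ v ∈ canonical (T \ A),
      (∀ x, x ∈ u ↔ x = m' ∨ x ∈ A) ∧ (∀ x, x ∈ v ↔ x ∈ T ∧ x ∉ A) := by
    intro A _ u hu v hv
    rw [mem_canonical] at hu hv
    constructor <;> intro x
    · rw [← List.mem_toFinset, hu.1.2, Finset.mem_insert]
    · rw [← List.mem_toFinset, hv.1.2, Finset.mem_sdiff]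
  simp_rw [← Finset.sum_product' _ _ fun u v => w (u ++ m :: v)]
  rw [Finset.sum_sigma']
  symm
  refine Finset.sum_bij (fun q _ => q.2.1 ++ m :: q.2.2) ?_ ?_ ?_ fun _ _ => rfl
  · rintro ⟨A, u, v⟩ hq
    simp only [Finset.mem_sigma, Finset.mem_powerset, Finset.mem_product] at hq
    obtain ⟨hA, hu, hv⟩ := hq
    obtain ⟨ku, kv⟩ := key A hA u hu v hv
    rw [mem_canonical] at hu hv ⊢
    refine ⟨⟨?_, ?_⟩, ?_⟩
    · rw [List.nodup_append, List.nodup_cons]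
      refine ⟨hu.1.1, ⟨?_, hv.1.1⟩, ?_⟩ <;> grind
    · ext x
      simp only [List.mem_toFinset, List.mem_append, List.mem_cons, Finset.mem_insert]
      grind
    · rw [canonNP_append_cons (m' := m')]
      · exact ⟨⟨hu.2, hv.2⟩, by grind⟩
      all_goals first | (intro x; grind) | grind
  · rintro ⟨A, u, v⟩ hq ⟨A', u', v'⟩ hq' h
    simp only [Finset.mem_sigma, Finset.mem_powerset, Finset.mem_product] at hq hq' h
    obtain ⟨hA, hu, hv⟩ := hq
    obtain ⟨hA', hu', hv'⟩ := hq'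
    obtain ⟨ku, kv⟩ := key A hA u hu v hv
    obtain ⟨ku', kv'⟩ := key A' hA' u' hu' v' hv'
    obtain ⟨rfl, -, rfl⟩ := (List.append_cons_inj_of_notMem (by grind) (by grind)).1 h
    obtain rfl : A = A' := by
      ext x
      grind
    rfl
  · intro l hl
    rw [mem_canonical] at hl
    obtain ⟨⟨hnd, hS⟩, hc⟩ := hl
    have hmem : ∀ x, x ∈ l ↔ x = m ∨ x = m' ∨ x ∈ T := by
      intro x
      rw [← List.mem_toFinset, hS, Finset.mem_insert, Finset.mem_insert]
    obtain ⟨u, v, rfl⟩ := List.append_of_mem ((hmem m).2 (Or.inl rfl))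
    rw [List.nodup_append, List.nodup_cons] at hnd
    obtain ⟨hu, ⟨hmv, hv⟩, huv⟩ := hnd
    simp only [List.mem_append, List.mem_cons] at hmem huv
    have hmu : m ∉ u := fun h => huv m h m (Or.inl rfl) rfl
    rw [canonNP_append_cons (m' := m') (by grind) (by grind) (by intro x; grind) (by grind)
      (by grind) (by grind)] at hc
    refine ⟨⟨u.toFinset.erase m', u, v⟩, ?_, rfl⟩
    simp only [Finset.mem_sigma, Finset.mem_powerset, Finset.mem_product, mem_canonical]
    refine ⟨?_, ⟨⟨hu, ?_⟩, hc.1.1⟩, ⟨hv, ?_⟩, hc.1.2⟩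
    · intro x
      simp only [Finset.mem_erase, List.mem_toFinset]
      grind
    · rw [Finset.insert_erase (by simpa using hc.2)]
    · ext x
      simp only [Finset.mem_sdiff, Finset.mem_erase, List.mem_toFinset]
      grind

lemma countBal_zero_append_cons {u v : List ℕ} {m : ℕ} (hu : ∀ x ∈ u, x < m)
    (hv : ∀ x ∈ v, x < m) (hne : u ≠ []) :
    countBal 0 (treeOf (u ++ m :: v)) = countBal 0 (treeOf u) + countBal 0 (treeOf v) := by
  rw [treeOf_append_cons hu hv, countBal]
  obtain ⟨x, u, rfl⟩ := List.exists_cons_of_ne_nil hne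
  obtain ⟨s, s', hs⟩ := treeOf_cons x u
  rw [hs, Nat.add_eq_left, ite_eq_right_iff]
  intro h
  cases ht : treeOf v with
  | nil => simp [ht, balRank] at h
  | node b t t' =>
    rw [ht, balRank] at h
    split at h
    · split at h <;> simp at h
    · simp at h

lemma exists_eq_insert_of_card {S : Finset ℕ} {n : ℕ} (hS : S.card = n + 1) :
    ∃ m T, (∀ x ∈ T, x < m) ∧ T.card = n ∧ S = insert m T := by
  have hne : S.Nonempty := by rw [← Finset.card_pos]; omega
  refine ⟨S.max' hne, S.erase (S.max' hne), fun x hx => ?_, ?_, ?_⟩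
  · exact S.lt_max'_of_mem_erase_max' hne hx
  · rw [Finset.card_erase_of_mem (S.max'_mem hne), hS, Nat.add_sub_cancel]
  · rw [Finset.insert_erase (S.max'_mem hne)]

variable {R : Type*} [CommSemiring R]

lemma card_canonical {e : ℕ → R} (e0 : e 0 = 1) (e1 : e 1 = 1)
    (he : ∀ n, e (n + 2) = ∑ k ∈ Finset.range (n + 1), n.choose k * e (k + 1) * e (n - k))
    (S : Finset ℕ) : ((canonical S).card : R) = e S.card := by
  induction hn : S.card using Nat.strong_induction_on generalizing S with
  | _ n ih =>
  match n with
  | 0 => simp [Finset.card_eq_zero.1 hn, canonical_empty, e0]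
  | 1 =>
    obtain ⟨m, rfl⟩ := Finset.card_eq_one.1 hn
    simp [canonical_singleton, e1]
  | n + 2 =>
    obtain ⟨m, T', hm, hT', rfl⟩ := exists_eq_insert_of_card hn
    obtain ⟨m', T, hm', hT, rfl⟩ := exists_eq_insert_of_card hT'
    rw [Finset.card_eq_sum_ones, sum_canonical_insert_insert hm' (hm m' (by simp)), he]
    have hterm : ∀ A ∈ T.powerset, ((∑ u ∈ canonical (insert m' A), ∑ v ∈ canonical (T \ A), 1 : ℕ)
        : R) = e (A.card + 1) * e (n - A.card) := by
      intro A hA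
      rw [Finset.mem_powerset] at hA
      have hle := Finset.card_le_card hA
      have hcA : (insert m' A).card = A.card + 1 :=
        Finset.card_insert_of_notMem fun h => (hm' _ (hA h)).false
      have hcB : (T \ A).card = n - A.card := by rw [Finset.card_sdiff_of_subset hA, hT]
      rw [← ih _ (by omega) _ hcA, ← ih _ (by omega) _ hcB]
      simp
    rw [Nat.cast_sum, Finset.sum_congr rfl hterm,
      Finset.sum_powerset_apply_card (fun k => e (k + 1) * e (n - k)), hT]
    simp [mul_assoc]

lemma sum_countBal_zero_canonical {e f : ℕ → R} (e0 : e 0 = 1) (e1 : e 1 = 1)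
    (he : ∀ n, e (n + 2) = ∑ k ∈ Finset.range (n + 1), n.choose k * e (k + 1) * e (n - k))
    (f0 : f 0 = 0) (f1 : f 1 = 1)
    (hf : ∀ n, f (n + 2) = ∑ k ∈ Finset.range (n + 1), n.choose k * f (k + 1) * e (n - k) +
      ∑ k ∈ Finset.range (n + 1), n.choose k * e (k + 1) * f (n - k))
    (S : Finset ℕ) :
    ((∑ l ∈ canonical S, countBal 0 (treeOf l) : ℕ) : R) = f S.card := by
  induction hn : S.card using Nat.strong_induction_on generalizing S with
  | _ n ih =>
  match n with
  | 0 => simp [Finset.card_eq_zero.1 hn, canonical_empty, f0, treeOf, treeOfAux, countBal]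
  | 1 =>
    obtain ⟨m, rfl⟩ := Finset.card_eq_one.1 hn
    simp [canonical_singleton, f1, treeOf_singleton, countBal, balRank]
  | n + 2 =>
    obtain ⟨m, T', hm, hT', rfl⟩ := exists_eq_insert_of_card hn
    obtain ⟨m', T, hm', hT, rfl⟩ := exists_eq_insert_of_card hT'
    rw [sum_canonical_insert_insert hm' (hm m' (by simp)), hf]
    have hterm : ∀ A ∈ T.powerset,
        ((∑ u ∈ canonical (insert m' A), ∑ v ∈ canonical (T \ A),
          countBal 0 (treeOf (u ++ m :: v)) : ℕ) : R) =
        f (A.card + 1) * e (n - A.card) + e (A.card + 1) * f (n - A.card) := by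
      intro A hA
      rw [Finset.mem_powerset] at hA
      have hle := Finset.card_le_card hA
      have hcA : (insert m' A).card = A.card + 1 :=
        Finset.card_insert_of_notMem fun h => (hm' _ (hA h)).false
      have hcB : (T \ A).card = n - A.card := by rw [Finset.card_sdiff_of_subset hA, hT]
      have hsplit : ∀ u ∈ canonical (insert m' A), ∀ v ∈ canonical (T \ A),
          countBal 0 (treeOf (u ++ m :: v)) =
            countBal 0 (treeOf u) + countBal 0 (treeOf v) := by
        intro u hu v hv
        rw [mem_canonical] at hu hv
        have hu' : ∀ x, x ∈ u ↔ x = m' ∨ x ∈ A := fun x => by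
          rw [← List.mem_toFinset, hu.1.2, Finset.mem_insert]
        have hv' : ∀ x, x ∈ v ↔ x ∈ T ∧ x ∉ A := fun x => by
          rw [← List.mem_toFinset, hv.1.2, Finset.mem_sdiff]
        simp only [Finset.mem_insert] at hm
        exact countBal_zero_append_cons (by grind) (by grind) (by grind)
      rw [← ih _ (by omega) _ hcA, ← ih _ (by omega) _ hcB, ← hcA, ← hcB,
        ← card_canonical e0 e1 he, ← card_canonical e0 e1 he,
        Finset.sum_congr rfl fun u hu => Finset.sum_congr rfl (hsplit u hu)]
      simp only [Finset.sum_add_distrib, Finset.sum_const, smul_eq_mul, ← Finset.mul_sum]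
      push_cast
      ring
    rw [Nat.cast_sum, Finset.sum_congr rfl hterm,
      Finset.sum_powerset_apply_card
        (fun k => f (k + 1) * e (n - k) + e (k + 1) * f (n - k)), hT]
    simp [mul_assoc, Finset.sum_add_distrib]

lemma b_eq_sum_canonical (n k : ℕ) :
    b n k = ∑ l ∈ canonical (List.range' 1 n).toFinset, countBal k (treeOf l) := by
  have hnd : (npPerms n).Nodup :=
    (List.nodup_permutations _ (List.nodup_range' (step := 1))).filter _
  rw [b, ← List.sum_toFinset _ hnd]
  refine Finset.sum_congr ?_ fun _ _ => rfl
  ext l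
  rw [mem_canonical, List.mem_toFinset, npPerms, List.mem_filter, perms, List.mem_permutations]
  refine and_congr_left fun _ => ⟨fun h => ⟨h.nodup_iff.2 List.nodup_range', ?_⟩, fun h => ?_⟩
  · exact List.toFinset_eq_of_perm _ _ h
  · exact List.perm_of_nodup_nodup_toFinset_eq h.1 List.nodup_range' h.2

/-- The exponential generating function of the Euler numbers. -/
noncomputable def eulerGF (z : ℂ) : ℂ := Complex.cos z / (1 - Complex.sin z)

/-- The exponential generating function of the number of leaves. -/
noncomputable def leafGF (z : ℂ) : ℂ := (z - 1 + Complex.cos z) / (1 - Complex.sin z)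

lemma one_sub_sin_ne_zero {z : ℂ} (hz : z ∈ Metric.ball (0 : ℂ) (Real.pi / 2)) :
    1 - Complex.sin z ≠ 0 := by
  intro h
  obtain ⟨k, rfl⟩ := Complex.sin_eq_one_iff.1 (sub_eq_zero.1 h).symm
  rw [mem_ball_zero_iff] at hz
  have hcast : ((Real.pi : ℂ) / 2 + k * (2 * Real.pi)) =
      ((Real.pi / 2 + k * (2 * Real.pi) : ℝ) : ℂ) := by push_cast; ring
  rw [hcast, Complex.norm_real, Real.norm_eq_abs, abs_lt] at hz
  have hpi := Real.pi_pos
  have h1 : (k : ℝ) < 0 := by nlinarith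
  have h2 : (-1 : ℝ) < k := by nlinarith
  norm_cast at h1 h2
  omega

lemma hasDerivAt_one_sub_sin (z : ℂ) :
    HasDerivAt (fun z => 1 - Complex.sin z) (-Complex.cos z) z := by
  simpa using (Complex.hasDerivAt_sin z).const_sub 1

lemma hasDerivAt_eulerGF {z : ℂ} (hz : z ∈ Metric.ball (0 : ℂ) (Real.pi / 2)) :
    HasDerivAt eulerGF (1 / (1 - Complex.sin z)) z := by
  have h := one_sub_sin_ne_zero hz
  refine ((Complex.hasDerivAt_cos z).div (hasDerivAt_one_sub_sin z) h).congr_deriv ?_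
  field_simp
  linear_combination Complex.sin_sq_add_cos_sq z

lemma hasDerivAt_leafGF {z : ℂ} (hz : z ∈ Metric.ball (0 : ℂ) (Real.pi / 2)) :
    HasDerivAt leafGF (leafGF z * eulerGF z + 1) z := by
  have h := one_sub_sin_ne_zero hz
  refine ((((hasDerivAt_id z).sub_const 1).add (Complex.hasDerivAt_cos z)).div
    (hasDerivAt_one_sub_sin z) h).congr_deriv ?_
  simp only [leafGF, eulerGF, id, Pi.add_apply]
  field_simp
  ring

lemma deriv_deriv_eulerGF {z : ℂ} (hz : z ∈ Metric.ball (0 : ℂ) (Real.pi / 2)) :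
    deriv (deriv eulerGF) z = deriv eulerGF z * eulerGF z := by
  have h := one_sub_sin_ne_zero hz
  have heq : deriv eulerGF =ᶠ[nhds z] fun z => 1 / (1 - Complex.sin z) := by
    filter_upwards [Metric.isOpen_ball.mem_nhds hz] with w hw using (hasDerivAt_eulerGF hw).deriv
  have hdiv : HasDerivAt (fun z => 1 / (1 - Complex.sin z)) _ z :=
    (hasDerivAt_const z 1).div (hasDerivAt_one_sub_sin z) h
  rw [heq.deriv_eq, (hasDerivAt_eulerGF hz).deriv, hdiv.deriv, eulerGF]
  field_simp
  ring

lemma deriv_deriv_leafGF {z : ℂ} (hz : z ∈ Metric.ball (0 : ℂ) (Real.pi / 2)) :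
    deriv (deriv leafGF) z = deriv leafGF z * eulerGF z + deriv eulerGF z * leafGF z := by
  have heq : deriv leafGF =ᶠ[nhds z] fun z => leafGF z * eulerGF z + 1 := by
    filter_upwards [Metric.isOpen_ball.mem_nhds hz] with w hw using (hasDerivAt_leafGF hw).deriv
  have hy := (hasDerivAt_eulerGF hz).differentiableAt.hasDerivAt
  have hf := (hasDerivAt_leafGF hz).differentiableAt.hasDerivAt
  have hmul : HasDerivAt (fun z => leafGF z * eulerGF z + 1) _ z := (hf.mul hy).add_const 1
  rw [heq.deriv_eq, hmul.deriv]
  ring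

lemma differentiableOn_leafGF : DifferentiableOn ℂ leafGF (Metric.ball 0 (Real.pi / 2)) :=
  fun _ hz => (hasDerivAt_leafGF hz).differentiableAt.differentiableWithinAt

lemma zero_mem_ball : (0 : ℂ) ∈ Metric.ball (0 : ℂ) (Real.pi / 2) :=
  Metric.mem_ball_self (by positivity)

lemma analyticAt_eulerGF : AnalyticAt ℂ eulerGF 0 :=
  DifferentiableOn.analyticAt
    (fun _ hz => (hasDerivAt_eulerGF hz).differentiableAt.differentiableWithinAt)
    (Metric.isOpen_ball.mem_nhds zero_mem_ball)

lemma analyticAt_leafGF : AnalyticAt ℂ leafGF 0 :=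
  differentiableOn_leafGF.analyticAt (Metric.isOpen_ball.mem_nhds zero_mem_ball)

lemma iteratedDeriv_eulerGF (n : ℕ) :
    iteratedDeriv (n + 2) eulerGF 0 = ∑ k ∈ Finset.range (n + 1),
      n.choose k * iteratedDeriv (k + 1) eulerGF 0 * iteratedDeriv (n - k) eulerGF 0 := by
  have heq : deriv (deriv eulerGF) =ᶠ[nhds 0] deriv eulerGF * eulerGF := by
    filter_upwards [Metric.isOpen_ball.mem_nhds zero_mem_ball] with w hw
      using deriv_deriv_eulerGF hw
  rw [iteratedDeriv_succ', iteratedDeriv_succ', (heq.iteratedDeriv n).eq_of_nhds,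
    iteratedDeriv_mul analyticAt_eulerGF.deriv.contDiffAt analyticAt_eulerGF.contDiffAt]
  simp only [iteratedDeriv_succ']

lemma iteratedDeriv_leafGF (n : ℕ) :
    iteratedDeriv (n + 2) leafGF 0 = ∑ k ∈ Finset.range (n + 1),
      n.choose k * iteratedDeriv (k + 1) leafGF 0 * iteratedDeriv (n - k) eulerGF 0 +
      ∑ k ∈ Finset.range (n + 1),
      n.choose k * iteratedDeriv (k + 1) eulerGF 0 * iteratedDeriv (n - k) leafGF 0 := by
  have heq : deriv (deriv leafGF) =ᶠ[nhds 0]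
      deriv leafGF * eulerGF + deriv eulerGF * leafGF := by
    filter_upwards [Metric.isOpen_ball.mem_nhds zero_mem_ball] with w hw
      using deriv_deriv_leafGF hw
  have hy := analyticAt_eulerGF
  have hf := analyticAt_leafGF
  rw [iteratedDeriv_succ', iteratedDeriv_succ', (heq.iteratedDeriv n).eq_of_nhds,
    iteratedDeriv_add (hf.deriv.mul hy).contDiffAt (hy.deriv.mul hf).contDiffAt,
    iteratedDeriv_mul hf.deriv.contDiffAt hy.contDiffAt,
    iteratedDeriv_mul hy.deriv.contDiffAt hf.contDiffAt]
  simp only [iteratedDeriv_succ']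

lemma b_zero_eq_iteratedDeriv (n : ℕ) : (b n 0 : ℂ) = iteratedDeriv n leafGF 0 := by
  have h := sum_countBal_zero_canonical (e := fun n => iteratedDeriv n eulerGF 0)
    (f := fun n => iteratedDeriv n leafGF 0) (by simp [eulerGF])
    (by simp [(hasDerivAt_eulerGF zero_mem_ball).deriv]) iteratedDeriv_eulerGF
    (by simp [leafGF]) (by simp [(hasDerivAt_leafGF zero_mem_ball).deriv, leafGF])
    iteratedDeriv_leafGF (List.range' 1 n).toFinset
  rw [b_eq_sum_canonical, h, List.toFinset_card_of_nodup List.nodup_range', List.length_range']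

end BalancedTrees

/-- For every real `x` with `|x| < π/2`, the series `∑_{n≥1} b(n,0) xⁿ/n!`
converges with sum `(x - 1 + cos x)/(1 - sin x)`, where `b(n,0)` is the total
number of leaves in all non-plane 1-2 trees on `{1,…,n}`. -/
theorem statement10 (x : ℝ) (hx : |x| < Real.pi / 2) :
    HasSum
      (fun n : ℕ =>
        (b (n + 1) 0 : ℝ) * x ^ (n + 1) / (Nat.factorial (n + 1) : ℝ))
      ((x - 1 + Real.cos x) / (1 - Real.sin x)) := by
  rw [← Complex.hasSum_ofReal]
  have hmem : (x : ℂ) ∈ Metric.ball (0 : ℂ) (Real.pi / 2) := by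
    rwa [mem_ball_zero_iff, Complex.norm_real]
  have h := (hasSum_nat_add_iff' 1).2
    (Complex.hasSum_taylorSeries_on_ball differentiableOn_leafGF hmem)
  have hval : leafGF x - ∑ i ∈ Finset.range 1,
      ((Nat.factorial i : ℂ))⁻¹ • ((x : ℂ) - 0) ^ i • iteratedDeriv i leafGF 0 =
      (((x - 1 + Real.cos x) / (1 - Real.sin x) : ℝ) : ℂ) := by
    simp [leafGF]
  rw [hval] at h
  refine h.congr_fun fun n => ?_
  rw [← b_zero_eq_iteratedDeriv]
  push_cast [smul_eq_mul, sub_zero]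
  field_simp
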